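/- Let k be a field with char(k) ≠ 2 and k ≠ k². Then every 2-dimensional unital associative k-algebra is isomorphic to exactly one of: k_(0,0), k_(0,1), or k_(d,0) = k(√d) for some non-square d ∈ k \ k²; moreover k_(d,0) ≅ k_(d',0) for non-squares d, d' if and only if d = q² d' for some q ∈ k*, and no k_(d,0) with d a non-square is isomorphic to k_(0,0) or k_(0,1). Consequently the number of isomorphism classes of 2-dimensional unital associative k-algebras is 1 + [k* : (k²)*], where [k* : (k²)*] is the index of the subgroup of nonzero squares in the multiplicative group k*. -/

import Mathlib

universe u v

open Polynomial

/-- The 2-dimensional algebra `k_(a,b) = k[X]/(X² − bX − a)`, with basis `{1, x}` and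
`x² = a·1 + b·x`. -/
noncomputable abbrev kTwoDim (k : Type u) [Field k] (a b : k) : Type u :=
  AdjoinRoot (X ^ 2 - C b * X - C a : Polynomial k)

/-- The `k`-algebra isomorphism relation on the parameter space `k × k` of the algebras
`k_(a,b)`. -/
def twoDimIsoSetoid (k : Type u) [Field k] : Setoid (k × k) where
  r p q := Nonempty (kTwoDim k p.1 p.2 ≃ₐ[k] kTwoDim k q.1 q.2)
  iseqv := ⟨fun _ => ⟨AlgEquiv.refl⟩, fun ⟨e⟩ => ⟨e.symm⟩, fun ⟨e⟩ ⟨f⟩ => ⟨e.trans f⟩⟩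

/-- The subgroup `(k²)*` of nonzero squares of the multiplicative group `k*`. -/
def squaresSubgroup (k : Type u) [Field k] : Subgroup kˣ :=
  MonoidHom.range (powMonoidHom 2 : kˣ →* kˣ)

namespace QuadraticAlgebra

variable {k : Type*} [Field k]

theorem nonempty_algEquiv_of_mul_self {B : Type*} [Ring B] [Algebra k B]
    (hB : Module.finrank k B = 2) {a b : k} {y : B} (hy : y ∉ Set.range (algebraMap k B))
    (h : y * y = a • 1 + b • y) : Nonempty (QuadraticAlgebra k a b ≃ₐ[k] B) := by
  have : Module.Finite k B := Module.finite_of_finrank_pos (by omega)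
  have : Nontrivial B := Module.nontrivial_of_finrank_pos (R := k) (by omega)
  let f : QuadraticAlgebra k a b →ₐ[k] B := lift ⟨y, h⟩
  have hf (z : QuadraticAlgebra k a b) : f z = z.re • 1 + z.im • y := rfl
  have hinj : Function.Injective f := by
    refine (injective_iff_map_eq_zero f).2 fun z hz => ?_
    rw [hf] at hz
    have him : z.im = 0 := by
      by_contra h0
      refine hy ⟨-z.re / z.im, ?_⟩
      rw [Algebra.algebraMap_eq_smul_one]
      apply smul_right_injective B h0
      simp only [smul_smul, mul_div_cancel₀ _ h0]
      rw [neg_smul]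
      exact neg_eq_of_add_eq_zero_right hz
    ext
    · simpa [him] using hz
    · simpa using him
  have hsurj : Function.Surjective f :=
    (LinearMap.injective_iff_surjective_of_finrank_eq_finrank (f := f.toLinearMap)
      ((finrank_eq_two a b).trans hB.symm)).1 hinj
  exact ⟨AlgEquiv.ofBijective f ⟨hinj, hsurj⟩⟩

theorem exists_nonempty_algEquiv_of_finrank_eq_two {B : Type*} [Ring B] [Algebra k B]
    (hB : Module.finrank k B = 2) : ∃ a b : k, Nonempty (QuadraticAlgebra k a b ≃ₐ[k] B) := by
  have : Nontrivial B := Module.nontrivial_of_finrank_pos (R := k) (by omega)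
  obtain ⟨y, hy⟩ : ∃ y : B, y ∉ Set.range (algebraMap k B) := by
    by_contra! hall
    have := finrank_le_one (R := k) (1 : B) fun w => by
      obtain ⟨c, hc⟩ := hall w
      exact ⟨c, by rw [← hc, Algebra.algebraMap_eq_smul_one]⟩
    omega
  have hli : LinearIndependent k ![(1 : B), y] := by
    refine (LinearIndependent.pair_iff' one_ne_zero).2 fun c hc => hy ⟨c, ?_⟩
    rw [Algebra.algebraMap_eq_smul_one, hc]
  have hspan := hli.span_eq_top_of_card_eq_finrank (by simp [hB])
  have hmem : y * y ∈ Submodule.span k (Set.range ![(1 : B), y]) := hspan ▸ Submodule.mem_top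
  rw [Matrix.range_cons_cons_empty, Submodule.mem_span_pair] at hmem
  obtain ⟨a, b, hab⟩ := hmem
  exact ⟨a, b, nonempty_algEquiv_of_mul_self hB hy hab.symm⟩

/-- Quadratic algebras in characteristic not two are classified by the discriminant `b ^ 2 + 4 * a`
up to nonzero squares. -/
theorem nonempty_algEquiv_iff (h2 : (2 : k) ≠ 0) (a b c d : k) :
    Nonempty (QuadraticAlgebra k a b ≃ₐ[k] QuadraticAlgebra k c d) ↔
      ∃ q : k, q ≠ 0 ∧ b ^ 2 + 4 * a = q ^ 2 * (d ^ 2 + 4 * c) := by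
  constructor
  · rintro ⟨e⟩
    set y := e omega with hy
    have hyy : y * y = a • 1 + b • y := by
      rw [hy, ← map_mul, omega_mul_omega_eq_add]
      simp
    have hq : y.im ≠ 0 := by
      intro h0
      have h1 : e omega = e (algebraMap k _ y.re) := by
        rw [e.commutes, ← hy]
        ext <;> simp [h0]
      simpa using congrArg im (e.injective h1)
    have hre := congrArg re hyy
    have him := congrArg im hyy
    simp at hre him
    have hb : 2 * y.re + y.im * d = b := by
      apply mul_right_cancel₀ hq
      linear_combination him
    refine ⟨y.im, hq, ?_⟩
    linear_combination (-4) * hre - (b - 2 * y.re + y.im * d) * hb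
  · rintro ⟨q, hq, h⟩
    have h4 : (4 : k) ≠ 0 := by
      have := mul_ne_zero h2 h2
      norm_num at this
      exact this
    refine nonempty_algEquiv_of_mul_self (finrank_eq_two c d) (y := ⟨(b - q * d) / 2, q⟩) ?_ ?_
    · rintro ⟨r, hr⟩
      exact hq (by simpa using (congrArg im hr).symm)
    · ext
      · simp
        field_simp
        linear_combination (-1) * h
      · simp
        field_simp
        ring

end QuadraticAlgebra

section

variable {k : Type u} [Field k]

theorem finrank_kTwoDim (a b : k) : Module.finrank k (kTwoDim k a b) = 2 := by
  have hm : (X ^ 2 - C b * X - C a : k[X]).Monic := by monicity!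
  rw [(AdjoinRoot.powerBasis' hm).finrank, AdjoinRoot.powerBasis'_dim]
  compute_degree!

theorem nonempty_kTwoDim_algEquiv (a b : k) :
    Nonempty (kTwoDim k a b ≃ₐ[k] QuadraticAlgebra k a b) := by
  set f : k[X] := X ^ 2 - C b * X - C a with hf
  have hdeg : f.natDegree = 2 := by rw [hf]; compute_degree!
  refine (QuadraticAlgebra.nonempty_algEquiv_of_mul_self (finrank_kTwoDim a b)
    (y := AdjoinRoot.root f) ?_ ?_).map AlgEquiv.symm
  · rintro ⟨r, hr⟩
    have h0 : AdjoinRoot.mk f (X - C r) = 0 := by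
      rw [map_sub, AdjoinRoot.mk_X, AdjoinRoot.mk_C, ← hr]
      exact sub_self _
    have := natDegree_le_of_dvd (AdjoinRoot.mk_eq_zero.1 h0) (X_sub_C_ne_zero r)
    rw [hdeg, natDegree_X_sub_C] at this
    omega
  · have h0 : AdjoinRoot.mk f (X ^ 2 - C b * X - C a) = 0 := AdjoinRoot.mk_self
    simp only [map_sub, map_mul, map_pow, AdjoinRoot.mk_X, AdjoinRoot.mk_C] at h0
    rw [Algebra.smul_def, Algebra.smul_def, AdjoinRoot.algebraMap_eq]
    linear_combination h0

theorem exists_nonempty_algEquiv_kTwoDim {B : Type v} [Ring B] [Algebra k B]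
    (hB : Module.finrank k B = 2) : ∃ a b : k, Nonempty (B ≃ₐ[k] kTwoDim k a b) := by
  obtain ⟨a, b, ⟨e⟩⟩ := QuadraticAlgebra.exists_nonempty_algEquiv_of_finrank_eq_two hB
  obtain ⟨f⟩ := nonempty_kTwoDim_algEquiv a b
  exact ⟨a, b, ⟨e.symm.trans f.symm⟩⟩

theorem nonempty_kTwoDim_algEquiv_iff (h2 : (2 : k) ≠ 0) (a b c d : k) :
    Nonempty (kTwoDim k a b ≃ₐ[k] kTwoDim k c d) ↔
      ∃ q : k, q ≠ 0 ∧ b ^ 2 + 4 * a = q ^ 2 * (d ^ 2 + 4 * c) := by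
  rw [← QuadraticAlgebra.nonempty_algEquiv_iff h2]
  obtain ⟨e⟩ := nonempty_kTwoDim_algEquiv a b
  obtain ⟨f⟩ := nonempty_kTwoDim_algEquiv c d
  exact ⟨fun ⟨g⟩ => ⟨(e.symm.trans g).trans f⟩, fun ⟨g⟩ => ⟨(e.trans g).trans f.symm⟩⟩

theorem nonempty_kTwoDim_zero_right_iff (h2 : (2 : k) ≠ 0) (d d' : k) :
    Nonempty (kTwoDim k d 0 ≃ₐ[k] kTwoDim k d' 0) ↔ ∃ q : k, q ≠ 0 ∧ d = q ^ 2 * d' := by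
  have h4 : (4 : k) ≠ 0 := by
    have := mul_ne_zero h2 h2
    norm_num at this
    exact this
  rw [nonempty_kTwoDim_algEquiv_iff h2]
  refine exists_congr fun q => and_congr_right fun _ => ⟨fun h => ?_, fun h => ?_⟩
  · apply mul_left_cancel₀ h4
    linear_combination h
  · linear_combination 4 * h

theorem nonempty_kTwoDim_algEquiv_zero_right (h2 : (2 : k) ≠ 0) (a b : k) :
    Nonempty (kTwoDim k a b ≃ₐ[k] kTwoDim k (b ^ 2 + 4 * a) 0) := by
  rw [nonempty_kTwoDim_algEquiv_iff h2]
  refine ⟨1 / 2, by simpa using h2, ?_⟩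
  field_simp
  ring

theorem nonempty_kTwoDim_unit_algEquiv_iff (h2 : (2 : k) ≠ 0) (u v : kˣ) :
    Nonempty (kTwoDim k u 0 ≃ₐ[k] kTwoDim k v 0) ↔
      (u : kˣ ⧸ squaresSubgroup k) = v := by
  rw [nonempty_kTwoDim_zero_right_iff h2, eq_comm, QuotientGroup.eq]
  constructor
  · rintro ⟨q, hq, h⟩
    refine ⟨Units.mk0 q hq, Units.ext ?_⟩
    simp [h]
    field_simp
  · rintro ⟨q, hq⟩
    refine ⟨q, q.ne_zero, ?_⟩
    have : u = q ^ 2 * v := by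
      rw [show q ^ 2 = v⁻¹ * u from hq]
      simp [mul_comm]
    simp [this]

theorem mk_quotient_twoDimIsoSetoid (h2 : (2 : k) ≠ 0) :
    Cardinal.mk (Quotient (twoDimIsoSetoid k)) =
      1 + Cardinal.mk (kˣ ⧸ squaresSubgroup k) := by
  have hrel (p q : k × k) : (Quotient.mk (twoDimIsoSetoid k) p = Quotient.mk _ q) ↔
      Nonempty (kTwoDim k p.1 p.2 ≃ₐ[k] kTwoDim k q.1 q.2) := Quotient.eq
  let g : kˣ ⧸ squaresSubgroup k → Quotient (twoDimIsoSetoid k) :=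
    Quotient.lift (fun u : kˣ => Quotient.mk _ ((u : k), (0 : k))) fun u v huv =>
      (hrel _ _).2 ((nonempty_kTwoDim_unit_algEquiv_iff h2 u v).2 (Quotient.sound huv))
  have hg (u : kˣ) : g (u : kˣ ⧸ squaresSubgroup k) = Quotient.mk _ ((u : k), (0 : k)) := rfl
  have hinj : Function.Injective g := by
    intro x y
    induction x using QuotientGroup.induction_on with | H u => ?_
    induction y using QuotientGroup.induction_on with | H v => ?_
    rw [hg, hg, hrel]
    exact (nonempty_kTwoDim_unit_algEquiv_iff h2 u v).1
  have hzero (x) : g x ≠ Quotient.mk _ (0, 0) := by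
    induction x using QuotientGroup.induction_on with | H u => ?_
    rw [hg, Ne, hrel, nonempty_kTwoDim_zero_right_iff h2]
    simp
  let F : Option (kˣ ⧸ squaresSubgroup k) → Quotient (twoDimIsoSetoid k) :=
    fun o => o.elim (Quotient.mk _ (0, 0)) g
  have hF : Function.Bijective F := by
    constructor
    · rintro (_ | x) (_ | y) h
      · rfl
      · exact (hzero y h.symm).elim
      · exact (hzero x h).elim
      · exact congrArg some (hinj h)
    · intro z
      induction z using Quotient.inductionOn with | h p => ?_
      have hp := (hrel p (p.2 ^ 2 + 4 * p.1, 0)).2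
        (nonempty_kTwoDim_algEquiv_zero_right h2 p.1 p.2)
      rw [hp]
      by_cases h0 : p.2 ^ 2 + 4 * p.1 = 0
      · exact ⟨none, by rw [h0]; rfl⟩
      · exact ⟨some (Units.mk0 _ h0 : kˣ), rfl⟩
  rw [← Cardinal.mk_congr (Equiv.ofBijective F hF), Cardinal.mk_option, add_comm]

end

/-- **Corollary 3.5 (3)**.  If `char k ≠ 2` and `k ≠ k²`, then every 2-dimensional unital
associative `k`-algebra is isomorphic to exactly one of `k_(0,0)`, `k_(0,1)`, or
`k_(d,0) = k(√d)` for a non-square `d`; moreover `k_(d,0) ≅ k_(d',0)` iff `d = q²d'` for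
some `q ∈ k*`, and the number of isomorphism classes of 2-dimensional `k`-algebras is
`1 + [k* : (k²)*]`. -/
theorem two_dimensional_algebras_char_ne_two_nonsquares (k : Type u) [Field k]
    (hchar : ringChar k ≠ 2) (hns : ∃ c : k, ∀ q : k, q ^ 2 ≠ c) :
    -- every 2-dimensional algebra is isomorphic to one of the list …
    (∀ (B : Type v) (_ : Ring B) (_ : Algebra k B), Module.finrank k B = 2 →
      Nonempty (B ≃ₐ[k] kTwoDim k 0 0) ∨ Nonempty (B ≃ₐ[k] kTwoDim k 0 1) ∨
        ∃ d : k, (∀ q : k, q ^ 2 ≠ d) ∧ Nonempty (B ≃ₐ[k] kTwoDim k d 0)) ∧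
    -- … and to exactly one: the listed algebras are pairwise non-isomorphic …
    IsEmpty (kTwoDim k 0 0 ≃ₐ[k] kTwoDim k 0 1) ∧
    (∀ d : k, (∀ q : k, q ^ 2 ≠ d) →
      IsEmpty (kTwoDim k d 0 ≃ₐ[k] kTwoDim k 0 0) ∧
      IsEmpty (kTwoDim k d 0 ≃ₐ[k] kTwoDim k 0 1)) ∧
    (∀ d d' : k, (∀ q : k, q ^ 2 ≠ d) → (∀ q : k, q ^ 2 ≠ d') →
      (Nonempty (kTwoDim k d 0 ≃ₐ[k] kTwoDim k d' 0) ↔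
        ∃ q : k, q ≠ 0 ∧ d = q ^ 2 * d')) ∧
    -- … so that there are exactly `1 + [k* : (k²)*]` isomorphism classes
    Cardinal.mk (Quotient (twoDimIsoSetoid k))
      = 1 + Cardinal.mk (kˣ ⧸ squaresSubgroup k) := by
  have h2 : (2 : k) ≠ 0 := Ring.two_ne_zero hchar
  have h01 (d : k) : Nonempty (kTwoDim k d 0 ≃ₐ[k] kTwoDim k 0 1) ↔ ∃ q : k, q ≠ 0 ∧ q ^ 2 = d := by
    obtain ⟨e⟩ : Nonempty (kTwoDim k 0 1 ≃ₐ[k] kTwoDim k 1 0) :=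
      (nonempty_kTwoDim_algEquiv_iff h2 0 1 1 0).2 ⟨1 / 2, by simpa using h2, by field_simp; ring⟩
    have := nonempty_kTwoDim_zero_right_iff h2 d 1
    simp only [mul_one] at this
    simp only [@eq_comm _ _ d, ← this]
    exact ⟨fun ⟨f⟩ => ⟨f.trans e⟩, fun ⟨f⟩ => ⟨f.trans e.symm⟩⟩
  refine ⟨fun B _ _ hB => ?_, ?_, fun d hd => ⟨?_, ?_⟩,
    fun d d' _ _ => nonempty_kTwoDim_zero_right_iff h2 d d', mk_quotient_twoDimIsoSetoid h2⟩
  · obtain ⟨a, b, ⟨e⟩⟩ := exists_nonempty_algEquiv_kTwoDim hB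
    obtain ⟨f⟩ := nonempty_kTwoDim_algEquiv_zero_right h2 a b
    generalize b ^ 2 + 4 * a = d at f
    by_cases hd : ∀ q : k, q ^ 2 ≠ d
    · exact .inr (.inr ⟨d, hd, ⟨e.trans f⟩⟩)
    push Not at hd
    obtain ⟨q, rfl⟩ := hd
    obtain rfl | hq := eq_or_ne q 0
    · rw [zero_pow two_ne_zero] at f
      exact .inl ⟨e.trans f⟩
    · obtain ⟨g⟩ := (h01 (q ^ 2)).2 ⟨q, hq, rfl⟩
      exact .inr (.inl ⟨(e.trans f).trans g⟩)
  · rw [← not_nonempty_iff, h01]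
    rintro ⟨q, hq, h⟩
    exact hq (pow_eq_zero_iff two_ne_zero |>.1 h)
  · rw [← not_nonempty_iff, nonempty_kTwoDim_zero_right_iff h2]
    rintro ⟨q, -, h⟩
    exact hd 0 (by simp [h])
  · rw [← not_nonempty_iff, h01]
    rintro ⟨q, -, h⟩
    exact hd q h
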